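/- arXiv:0707.2189 — 2 statements merged into one kernel-verified Lean document; each statement's English description precedes it below -/
import Mathlib

section
/- Let A be a commutative ring that is real closed *, and let B be a formally real commutative ring extension of A that is an essential extension of A. Then A is integrally closed in B, i.e. every element of B that is integral over A already lies in A. -/
universe u

/-- A commutative ring is formally real if a finite sum of squares can only vanish
when all the summands vanish. -/
def IsFormallyRealRing (R : Type*) [CommRing R] : Prop :=
  ∀ (n : ℕ) (f : Fin n → R), (∑ i, f i ^ 2) = 0 → ∀ i, f i = 0

/-- A subring `A` of `R` is essential in `R` if every nonzero ideal of `R` meets `A`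
in a nonzero element. -/
def Subring.IsEssentialIn {R : Type*} [CommRing R] (A : Subring R) : Prop :=
  ∀ I : Ideal R, I ≠ ⊥ → ∃ x ∈ I, x ∈ A ∧ x ≠ 0

/-- A commutative ring `A` is real closed * if it is formally real and it admits no
proper formally real extension ring that is both integral over `A` and an essential
extension of `A`: every embedding of `A` into a formally real ring `B` which is
integral over (the image of) `A` and essential over it is surjective. -/
def IsRealClosedStar (A : Type u) [CommRing A] : Prop :=
  IsFormallyRealRing A ∧
    ∀ (B : Type u) [CommRing B] (f : A →+* B), Function.Injective f →
      IsFormallyRealRing B →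
      (∀ b : B, ∃ p : Polynomial B, p.Monic ∧ (∀ n, p.coeff n ∈ f.range) ∧
        Polynomial.eval b p = 0) →
      (f.range : Subring B).IsEssentialIn →
      Function.Surjective f

open Polynomial in
/-- If `J` is an ideal of `C` meeting `A` trivially and `c ∈ J` has a multiple `b * c = a` in `A`
(the multiplier `b` living in a larger ring `B`), then a relation `a ^ k * p(c) = 0` kills the
top coefficient of `p` up to a power of `a`. -/
theorem pow_mul_coeff_eq_zero_of_comap_eq_bot {A C B : Type*} [CommRing A] [CommRing C]
    [CommRing B] [Algebra A C] (i : C →+* B) (hi : Function.Injective i)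
    (hAC : Function.Injective (algebraMap A C)) {J : Ideal C}
    (hJ : ∀ x : A, algebraMap A C x ∈ J → x = 0) {c : C} (hc : c ∈ J) {b : B} {a : A}
    (hab : i c * b = i (algebraMap A C a)) (n : ℕ) :
    ∀ (p : A[X]) (k : ℕ), p.natDegree ≤ n → algebraMap A C (a ^ k) * aeval c p = 0 →
      a ^ (k + n) * p.coeff n = 0 := by
  induction n with
  | zero =>
    intro p k hp h
    rw [eq_C_of_natDegree_le_zero hp, aeval_C, ← map_mul] at h
    exact (map_eq_zero_iff _ hAC).1 h
  | succ n ih =>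
    intro p k hp h
    have hsplit : aeval c p = aeval c p.divX * c + algebraMap A C (p.coeff 0) := by
      conv_lhs => rw [← divX_mul_X_add p]
      simp
    have h0 : a ^ k * p.coeff 0 = 0 := by
      apply hJ
      have : algebraMap A C (a ^ k * p.coeff 0) =
          -(algebraMap A C (a ^ k) * aeval c p.divX) * c := by
        rw [map_mul]
        linear_combination h - algebraMap A C (a ^ k) * hsplit
      rw [this]
      exact J.mul_mem_left _ hc
    have h1 : algebraMap A C (a ^ k) * aeval c p.divX * c = 0 := by
      have h0' := congrArg (algebraMap A C) h0
      rw [map_mul, map_zero] at h0'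
      linear_combination h - algebraMap A C (a ^ k) * hsplit - h0'
    have h2 : algebraMap A C (a ^ (k + 1)) * aeval c p.divX = 0 := by
      apply hi
      have h1' := congrArg i h1
      simp only [map_mul, map_zero, map_pow, pow_succ] at h1' ⊢
      linear_combination b * h1' - i (algebraMap A C a) ^ k * i (aeval c p.divX) * hab
    have h3 := ih p.divX (k + 1) (by rw [natDegree_divX_eq_natDegree_tsub_one]; omega) h2
    rwa [coeff_divX, add_assoc, add_comm 1 n] at h3

theorem IsFormallyRealRing.isReduced {R : Type*} [CommRing R] (h : IsFormallyRealRing R) :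
    IsReduced R := by
  refine isReduced_iff_pow_one_lt 2 one_lt_two |>.2 fun x hx => ?_
  exact h 1 (fun _ => x) (by simpa using hx) 0

theorem IsFormallyRealRing.of_injective {R S : Type*} [CommRing R] [CommRing S] (f : R →+* S)
    (hf : Function.Injective f) (h : IsFormallyRealRing S) : IsFormallyRealRing R := by
  intro n g hg i
  apply hf
  rw [map_zero]
  refine h n (fun i => f (g i)) ?_ i
  simpa using congrArg f hg

/-- Essentiality of a reduced ring passes to its integral closure in an essential extension. -/
theorem Subring.IsEssentialIn.algebraMap_integralClosure {B : Type*} [CommRing B] {A : Subring B}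
    [IsReduced A] (hess : A.IsEssentialIn) :
    (algebraMap A (integralClosure A B)).range.IsEssentialIn := by
  intro J hJ
  by_contra! hcon
  have hAC : Function.Injective (algebraMap A (integralClosure A B)) := fun x y h =>
    Subtype.ext (congrArg (fun z : integralClosure A B => (z : B)) h)
  have hJA (x : A) (hx : algebraMap A (integralClosure A B) x ∈ J) : x = 0 :=
    (map_eq_zero_iff _ hAC).1 (hcon _ hx ⟨x, rfl⟩)
  obtain ⟨c, hcJ, hc⟩ := Submodule.exists_mem_ne_zero_of_ne_bot hJ
  obtain ⟨a, hac, haA, ha⟩ := hess (Ideal.span {(c : B)}) (by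
    simpa [Ideal.span_singleton_eq_bot] using hc)
  obtain ⟨b, rfl⟩ := Ideal.mem_span_singleton.1 hac
  obtain ⟨p, hp, hpc⟩ := integralClosure.isIntegral c
  have h := pow_mul_coeff_eq_zero_of_comap_eq_bot
    (integralClosure A B).val.toRingHom Subtype.val_injective hAC hJA hcJ
    (b := b) (a := ⟨_, haA⟩) rfl p.natDegree p 0 le_rfl
    (by rw [Polynomial.aeval_def, hpc, mul_zero])
  rw [hp.coeff_natDegree, mul_one] at h
  exact ha (congrArg Subtype.val (IsReduced.eq_zero _ ⟨_, h⟩))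

/-- Let `A` be a commutative ring that is real closed *, and let `B` be a
formally real commutative ring extension of `A` that is an essential extension of `A`.
Then `A` is integrally closed in `B`: every element of `B` integral over `A` (i.e.
satisfying a monic polynomial with coefficients in `A`) already lies in `A`. -/
theorem stmt_2 {B : Type u} [CommRing B] (A : Subring B)
    (hA : IsRealClosedStar A) (hB : IsFormallyRealRing B)
    (hess : A.IsEssentialIn) :
    ∀ b : B, (∃ p : Polynomial B, p.Monic ∧ (∀ n, p.coeff n ∈ A) ∧
      Polynomial.eval b p = 0) → b ∈ A := by
  rintro b ⟨p, hp, hpA, hpb⟩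
  have := hA.1.isReduced
  have hpA' : (p.coeffs : Set B) ⊆ A := fun x hx => by
    obtain ⟨n, -, rfl⟩ := Polynomial.mem_coeffs_iff.1 hx
    exact hpA n
  have hb : IsIntegral A b := by
    refine ⟨p.toSubring A hpA', (Polynomial.monic_toSubring _ _ _).2 hp, ?_⟩
    rw [Polynomial.eval₂_eq_eval_map]
    exact (congrArg (Polynomial.eval b) (Polynomial.map_toSubring p A hpA')).trans hpb
  obtain ⟨a, ha⟩ := hA.2 (integralClosure A B) (algebraMap A _)
    (fun x y h => Subtype.ext (congrArg (fun z : integralClosure A B => (z : B)) h))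
    (hB.of_injective (integralClosure A B).val.toRingHom Subtype.val_injective)
    (fun c => by
      obtain ⟨q, hq, hqc⟩ := integralClosure.isIntegral c
      refine ⟨q.map (algebraMap A _), hq.map _, fun n => ?_, ?_⟩
      · rw [Polynomial.coeff_map]
        exact ⟨_, rfl⟩
      · rwa [Polynomial.eval_map])
    hess.algebraMap_integralClosure ⟨b, hb⟩
  rw [← show (a : B) = b from congrArg Subtype.val ha]
  exact a.2
end

section
/- Let I be an index set and for each i ∈ I let A_i be a commutative ring that is real closed *. Then the product ring ∏_{i∈I} A_i is real closed *. -/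
universe u v

open Polynomial in
theorem forall_exists_monic_coeff_mem_range_iff {A B : Type*} [CommRing A] [CommRing B]
    (f : A →+* B) :
    (∀ b : B, ∃ p : B[X], p.Monic ∧ (∀ n, p.coeff n ∈ f.range) ∧ p.eval b = 0) ↔
      f.IsIntegral := by
  refine forall_congr' fun b ↦ ⟨?_, ?_⟩
  · rintro ⟨p, hp, hc, h0⟩
    obtain ⟨q, rfl, -, hq⟩ :=
      lifts_and_natDegree_eq_and_monic ((lifts_iff_coeff_lifts p).2 hc) hp
    exact ⟨q, hq, by rwa [eval_map] at h0⟩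
  · rintro ⟨q, hq, h0⟩
    exact ⟨q.map f, hq.map f, fun n ↦ ⟨q.coeff n, by simp⟩, by rwa [eval_map]⟩

theorem RingHom.isEssentialIn_range_iff {A B : Type*} [CommRing A] [CommRing B] (f : A →+* B) :
    f.range.IsEssentialIn ↔ ∀ x : B, x ≠ 0 → ∃ y a, x * y = f a ∧ f a ≠ 0 := by
  constructor
  · intro h x hx
    obtain ⟨z, hz, ⟨a, rfl⟩, h0⟩ := h (Ideal.span {x}) (by simpa using hx)
    obtain ⟨y, hy⟩ := Ideal.mem_span_singleton'.1 hz
    exact ⟨y, a, by rw [mul_comm, hy], h0⟩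
  · intro h I hI
    obtain ⟨x, hx, h0⟩ := Submodule.exists_mem_ne_zero_of_ne_bot hI
    obtain ⟨y, a, hy, ha⟩ := h x h0
    exact ⟨f a, hy ▸ I.mul_mem_right y hx, ⟨a, rfl⟩, ha⟩

namespace IsFormallyRealRing

variable {R S : Type*} [CommRing R] [CommRing S]

theorem of_injective_s9 (hS : IsFormallyRealRing S) (f : R →+* S) (hf : Function.Injective f) :
    IsFormallyRealRing R := by
  intro n x hx i
  refine (map_eq_zero_iff f hf).1 (hS n (fun i ↦ f (x i)) ?_ i)
  simpa using congrArg f hx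

theorem isReduced_s9 (hR : IsFormallyRealRing R) : IsReduced R :=
  isReduced_iff_pow_one_lt 2 one_lt_two |>.2 fun x hx ↦ hR 1 (fun _ ↦ x) (by simpa using hx) 0

theorem pi {ι : Type*} {A : ι → Type*} [∀ i, CommRing (A i)]
    (h : ∀ i, IsFormallyRealRing (A i)) : IsFormallyRealRing (∀ i, A i) := by
  intro n x hx j
  funext i
  exact h i n (fun j ↦ x j i) (by simpa using congrFun hx i) j

end IsFormallyRealRing

theorem IsIdempotentElem.mem_span_one_sub_iff {R : Type*} [CommRing R] {e : R}
    (he : IsIdempotentElem e) {x : R} : x ∈ Ideal.span {1 - e} ↔ e * x = 0 := by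
  rw [Ideal.mem_span_singleton']
  constructor
  · rintro ⟨y, rfl⟩
    linear_combination -y * he.eq
  · intro h
    exact ⟨x, by linear_combination -h⟩

theorem IsFormallyRealRing.quotient_span_one_sub {R : Type*} [CommRing R]
    (hR : IsFormallyRealRing R) {e : R} (he : IsIdempotentElem e) :
    IsFormallyRealRing (R ⧸ Ideal.span {1 - e}) := by
  intro n x hx i
  choose y hy using fun i ↦ Ideal.Quotient.mk_surjective (x i)
  obtain rfl : (fun i ↦ Ideal.Quotient.mk _ (y i)) = x := funext hy
  simp only [← map_pow, ← map_sum, Ideal.Quotient.eq_zero_iff_mem,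
    he.mem_span_one_sub_iff] at hx ⊢
  refine hR n (fun i ↦ e * y i) ?_ i
  simp only [mul_pow, ← Finset.mul_sum, pow_two e, he.eq, hx]

open Polynomial in
/-- Let `x` in a reduced ring `C` be integral over `A`. If `x` has a multiple in a larger ring `B`
that is a nonzero element of `A`, then it already has such a multiple in `C`. -/
theorem exists_mul_eq_map_ne_zero_of_monic {A B C : Type*} [CommRing A] [CommRing B] [CommRing C]
    [IsReduced C] (g : A →+* C) (j : C →+* B) (hj : Function.Injective j) {x : C} {y : B} {a : A}
    (hxy : j x * y = j (g a)) (ha : g a ≠ 0) (n : ℕ) :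
    ∀ (k : ℕ) (p : A[X]), p.Monic → p.natDegree = n → g a ^ k * p.eval₂ g x = 0 →
      ∃ z b, x * z = g b ∧ g b ≠ 0 := by
  induction n with
  | zero =>
    intro k p hp hn h0
    rw [hp.natDegree_eq_zero.1 hn, eval₂_one, mul_one] at h0
    exact absurd (eq_zero_of_pow_eq_zero h0) ha
  | succ n ih =>
    intro k p hp hn h0
    have hq : p.divX.natDegree = n := by rw [natDegree_divX_eq_natDegree_tsub_one, hn]; rfl
    have hqm : p.divX.Monic := by
      rw [Monic, leadingCoeff, hq, coeff_divX, ← hn]; exact hp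
    rw [← divX_mul_X_add p, eval₂_add, eval₂_mul, eval₂_X, eval₂_C] at h0
    by_cases hb : g (a ^ k * p.coeff 0) = 0
    · refine ih (k + 1) p.divX hqm hq (hj ?_)
      have h1 : g a ^ k * p.divX.eval₂ g x * x = 0 := by
        rw [map_mul, map_pow] at hb
        linear_combination h0 - hb
      have h2 := congrArg j h1
      simp only [map_mul, map_pow, map_zero] at h2 ⊢
      linear_combination y * h2 - j (g a) ^ k * j (p.divX.eval₂ g x) * hxy
    · refine ⟨-(g a ^ k * p.divX.eval₂ g x), a ^ k * p.coeff 0, ?_, hb⟩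
      rw [map_mul, map_pow]
      linear_combination -h0

theorem RingHom.isEssentialIn_range_of_comp {A B C : Type*} [CommRing A] [CommRing B] [CommRing C]
    [IsReduced C] (g : A →+* C) (j : C →+* B) (hj : Function.Injective j) (hg : g.IsIntegral)
    (hess : (j.comp g).range.IsEssentialIn) : g.range.IsEssentialIn := by
  rw [isEssentialIn_range_iff] at hess ⊢
  intro x hx
  obtain ⟨y, a, hy, ha⟩ := hess (j x) ((map_ne_zero_iff j hj).2 hx)
  obtain ⟨p, hp, h0⟩ := hg x
  exact exists_mul_eq_map_ne_zero_of_monic g j hj hy (fun h ↦ ha (by simp [h])) _ 0 p hp rfl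
    (by rw [h0, mul_zero])

/-- The defining property of a real closed * ring holds for extensions in every universe. -/
theorem IsRealClosedStar.surjective {A : Type u} {B : Type v} [CommRing A] [CommRing B]
    (hA : IsRealClosedStar A) (f : A →+* B) (hf : Function.Injective f)
    (hB : IsFormallyRealRing B) (hint : f.IsIntegral) (hess : f.range.IsEssentialIn) :
    Function.Surjective f := by
  intro b
  let φ : Polynomial A →+* B := Polynomial.eval₂RingHom f b
  have : Small.{u} φ.range := small_of_surjective φ.rangeRestrict_surjective
  let e : Shrink.{u} φ.range ≃+* φ.range := Shrink.ringEquiv φ.range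
  let j : Shrink.{u} φ.range →+* B := φ.range.subtype.comp e.toRingHom
  let g : A →+* Shrink.{u} φ.range :=
    (e.symm.toRingHom.comp φ.rangeRestrict).comp Polynomial.C
  have hj : Function.Injective j := Subtype.val_injective.comp e.injective
  have hjg : j.comp g = f := by
    ext a
    simp [j, g, φ]
  have hC : IsFormallyRealRing (Shrink.{u} φ.range) := hB.of_injective_s9 j hj
  have := hC.isReduced_s9
  have hg : g.IsIntegral := by
    intro x
    obtain ⟨p, hp, h0⟩ := hint (j x)
    refine ⟨p, hp, hj ?_⟩
    rw [Polynomial.hom_eval₂, hjg, h0, map_zero]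
  obtain ⟨a, ha⟩ := hA.2 _ g
    (Function.Injective.of_comp (f := j) (by rw [← RingHom.coe_comp, hjg]; exact hf)) hC
    ((forall_exists_monic_coeff_mem_range_iff g).2 hg)
    (g.isEssentialIn_range_of_comp j hj hg (by rwa [hjg]))
    (e.symm (φ.rangeRestrict Polynomial.X))
  refine ⟨a, ?_⟩
  rw [← hjg, RingHom.comp_apply, ha]
  simp [j, φ]

section Pi

variable {ι : Type*} [DecidableEq ι] {A : ι → Type*} [∀ i, CommRing (A i)] {B : Type*} [CommRing B]

theorem isIdempotentElem_map_single_one (f : (∀ i, A i) →+* B) (i : ι) :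
    IsIdempotentElem (f (Pi.single i 1)) := by
  rw [IsIdempotentElem, ← map_mul, ← Pi.single_mul, mul_one]

theorem map_single_one_mul (f : (∀ i, A i) →+* B) (i : ι) (a : ∀ i, A i) :
    f (Pi.single i 1) * f a = f (Pi.single i (a i)) := by
  rw [← map_mul, ← Pi.single_mul_left, one_mul]

/-- The map from the factor `A i` to the corresponding component of an extension of the product. -/
def componentHom (f : (∀ i, A i) →+* B) (i : ι) :
    A i →+* B ⧸ Ideal.span {1 - f (Pi.single i 1)} where
  toFun a := Ideal.Quotient.mk _ (f (Pi.single i a))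
  map_zero' := by simp
  map_add' a b := by rw [Pi.single_add, map_add, map_add]
  map_mul' a b := by rw [Pi.single_mul, map_mul, map_mul]
  map_one' := ((Ideal.Quotient.mk_eq_mk_iff_sub_mem _ _).2 (Ideal.mem_span_singleton_self _)).symm

theorem componentHom_apply (f : (∀ i, A i) →+* B) (i : ι) (a : A i) :
    componentHom f i a = Ideal.Quotient.mk _ (f (Pi.single i a)) := rfl

theorem mk_eq_mk_iff_single_mul_eq (f : (∀ i, A i) →+* B) (i : ι) (x y : B) :
    Ideal.Quotient.mk (Ideal.span {1 - f (Pi.single i 1)}) x = Ideal.Quotient.mk _ y ↔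
      f (Pi.single i 1) * x = f (Pi.single i 1) * y := by
  rw [Ideal.Quotient.mk_eq_mk_iff_sub_mem,
    (isIdempotentElem_map_single_one f i).mem_span_one_sub_iff, mul_sub, sub_eq_zero]

theorem componentHom_eval (f : (∀ i, A i) →+* B) (i : ι) (a : ∀ i, A i) :
    componentHom f i (a i) = Ideal.Quotient.mk _ (f a) := by
  rw [componentHom_apply, mk_eq_mk_iff_single_mul_eq, map_single_one_mul, map_single_one_mul,
    Pi.single_eq_same]

theorem componentHom_injective {f : (∀ i, A i) →+* B} (hf : Function.Injective f) (i : ι) :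
    Function.Injective (componentHom f i) := by
  intro a b hab
  rw [componentHom_apply, componentHom_apply, mk_eq_mk_iff_single_mul_eq, map_single_one_mul,
    map_single_one_mul, Pi.single_eq_same, Pi.single_eq_same] at hab
  exact Pi.single_injective i (hf hab)

theorem componentHom_isIntegral {f : (∀ i, A i) →+* B} (hf : f.IsIntegral) (i : ι) :
    (componentHom f i).IsIntegral := by
  intro x
  obtain ⟨b, rfl⟩ := Ideal.Quotient.mk_surjective x
  obtain ⟨p, hp, h0⟩ := hf b
  refine ⟨p.map (Pi.evalRingHom A i), hp.map _, ?_⟩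
  have hcomp : (componentHom f i).comp (Pi.evalRingHom A i) = (Ideal.Quotient.mk _).comp f :=
    RingHom.ext fun a ↦ componentHom_eval f i a
  rw [Polynomial.eval₂_map, hcomp, ← Polynomial.hom_eval₂, h0, map_zero]

theorem componentHom_isEssentialIn {f : (∀ i, A i) →+* B} (hf : f.range.IsEssentialIn) (i : ι) :
    (componentHom f i).range.IsEssentialIn := by
  rw [RingHom.isEssentialIn_range_iff] at hf ⊢
  intro x hx
  obtain ⟨b, rfl⟩ := Ideal.Quotient.mk_surjective x
  have he := isIdempotentElem_map_single_one f i
  rw [Ne, Ideal.Quotient.eq_zero_iff_mem, he.mem_span_one_sub_iff] at hx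
  obtain ⟨y, a, hy, ha⟩ := hf _ hx
  have hea : f (Pi.single i 1) * f a = f a := by
    rw [← hy]
    linear_combination b * y * he.eq
  refine ⟨Ideal.Quotient.mk _ y, a i, ?_, ?_⟩
  · rw [componentHom_eval, ← map_mul, mk_eq_mk_iff_single_mul_eq, hea, ← hy, mul_assoc]
  · rwa [componentHom_eval, Ne, Ideal.Quotient.eq_zero_iff_mem, he.mem_span_one_sub_iff, hea]

theorem surjective_of_componentHom_surjective {f : (∀ i, A i) →+* B}
    (hf : Function.Injective f) (hess : f.range.IsEssentialIn) (h : ∀ i, Function.Surjective (componentHom f i)) :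
    Function.Surjective f := by
  intro b
  choose a ha using fun i ↦ h i (Ideal.Quotient.mk _ b)
  have hd (i : ι) : f (Pi.single i 1) * (f a - b) = 0 := by
    rw [mul_sub, sub_eq_zero, ← mk_eq_mk_iff_single_mul_eq, ← componentHom_eval, ha]
  refine ⟨a, sub_eq_zero.1 ?_⟩
  by_contra hne
  obtain ⟨y, c, hy, hc⟩ := f.isEssentialIn_range_iff.1 hess _ hne
  have hc0 : c = 0 := by
    funext i
    have h0 : f (Pi.single i (c i)) = 0 := by
      rw [← map_single_one_mul, ← hy, ← mul_assoc, hd, zero_mul]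
    exact Pi.single_eq_zero_iff.1 ((map_eq_zero_iff f hf).1 h0)
  exact hc (by rw [hc0, map_zero])

end Pi

/-- A product of commutative rings each of which is real closed * is
itself real closed *. -/
theorem stmt_9 {ι : Type v} (A : ι → Type u) [∀ i, CommRing (A i)]
    (h : ∀ i, IsRealClosedStar (A i)) :
    IsRealClosedStar (∀ i, A i) := by
  classical
  refine ⟨IsFormallyRealRing.pi fun i ↦ (h i).1, fun B _ f hf hB hint hess ↦ ?_⟩
  rw [forall_exists_monic_coeff_mem_range_iff] at hint
  exact surjective_of_componentHom_surjective hf hess fun i ↦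
    (h i).surjective (componentHom f i) (componentHom_injective hf i)
      (hB.quotient_span_one_sub (isIdempotentElem_map_single_one f i))
      (componentHom_isIntegral hint i) (componentHom_isEssentialIn hess i)
end
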